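/- arXiv:1701.00830 — 4 statements merged into one kernel-verified Lean document; each statement's English description precedes it below -/
import Mathlib

section
/- Let k be a field and R = k[t, t⁻¹] the Laurent polynomial ring. Then HH^i_k(R) = Ext^i_{R ⊗_k Rᵐᵒᵖ}(R, R) = 0 for every i ≥ 2. -/
open TensorProduct CategoryTheory

noncomputable section

/-- A `k`-algebra `A` is a module over its enveloping algebra `A ⊗[k] Aᵐᵒᵖ`, via
`(a ⊗ op b) • x = a * x * b`. -/
instance envModule (k A : Type) [Field k] [Ring A] [Algebra k A] :
    Module (A ⊗[k] Aᵐᵒᵖ) A := TensorProduct.Algebra.module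

/-- Hochschild cohomology `HH^n_k(A) := Ext^n_{A ⊗[k] Aᵐᵒᵖ}(A, A)`, computed in the category
of modules over the enveloping algebra `A ⊗[k] Aᵐᵒᵖ`, as a `k`-module. -/
def HH (k : Type) [Field k] (n : ℕ) (A : Type) [Ring A] [Algebra k A] : ModuleCat k :=
  ((Ext k (ModuleCat (A ⊗[k] Aᵐᵒᵖ)) n).obj
      (Opposite.op (ModuleCat.of (A ⊗[k] Aᵐᵒᵖ) A))).obj (ModuleCat.of (A ⊗[k] Aᵐᵒᵖ) A)

/-- The derived-functor `Ext^(n+1) X Y` vanishes when the group of Yoneda extensions of the same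
degree does. -/
lemma isZero_Ext_succ_of_subsingleton_abelianExt {k C : Type*} [Ring k] [Category* C] [Abelian C]
    [Linear k C] [EnoughProjectives C] [HasExt C] (X Y : C) (n : ℕ)
    [Subsingleton (Abelian.Ext X Y (n + 1))] :
    Limits.IsZero (((Ext k C (n + 1)).obj (Opposite.op X)).obj Y) := by
  let P := projectiveResolution X
  refine Limits.IsZero.of_iso ?_ (P.isoExt (n + 1) Y)
  rw [← HomologicalComplex.exactAt_iff_isZero_homology,
    HomologicalComplex.exactAt_iff' _ n (n + 1) (n + 2) (by simp) (by simp),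
    ShortComplex.moduleCat_exact_iff]
  intro f hf
  obtain ⟨g, hg⟩ := (P.extMk_eq_zero_iff f (n + 2) rfl hf n rfl).1 (Subsingleton.elim _ _)
  exact ⟨g, hg⟩

/-- A cyclic module over a commutative ring whose annihilator is generated by a regular element
has projective dimension at most `1`. -/
lemma hasProjectiveDimensionLT_two_of_regular {S M : Type} [CommRing S] [AddCommGroup M]
    [Module S M] (m : M) (hm : ∀ x : M, ∃ s : S, s • m = x) (f : S) (hf : IsSMulRegular S f)
    (hfm : ∀ s : S, s • m = 0 ↔ f ∣ s) :
    HasProjectiveDimensionLT (ModuleCat.of S M) 2 := by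
  let φ : S →ₗ[S] S := LinearMap.toSpanSingleton S S f
  let ψ : S →ₗ[S] M := LinearMap.toSpanSingleton S M m
  let E : ShortComplex (ModuleCat S) := ShortComplex.mk (ModuleCat.ofHom φ) (ModuleCat.ofHom ψ) (by
    ext
    simpa [φ, ψ] using (hfm f).2 dvd_rfl)
  have hE : E.ShortExact :=
    { exact := by
        rw [ShortComplex.moduleCat_exact_iff]
        intro s hs
        obtain ⟨c, hc⟩ := (hfm s).1 hs
        exact ⟨c, (mul_comm c f).trans hc.symm⟩
      mono_f := by
        rw [ModuleCat.mono_iff_injective]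
        intro a b hab
        exact hf (show f * a = f * b by simpa [mul_comm, E, φ] using hab)
      epi_g := by
        rw [ModuleCat.epi_iff_surjective]
        exact hm }
  have hS : Projective (ModuleCat.of S S) := (IsProjective.iff_projective (R := S) S).1 inferInstance
  have h₁ : HasProjectiveDimensionLT (ModuleCat.of S S) 1 := inferInstance
  have h₂ : HasProjectiveDimensionLT (ModuleCat.of S S) 2 := inferInstance
  exact hE.hasProjectiveDimensionLT_X₃ 1 h₁ h₂

namespace LaurentPolynomial

lemma algHom_ext_of_T_one {k A : Type*} [CommSemiring k] [Semiring A] [Algebra k A]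
    {φ ψ : LaurentPolynomial k →ₐ[k] A} (h : φ (T 1) = ψ (T 1)) : φ = ψ := by
  apply AddMonoidAlgebra.algHom_ext'
  · exact MonoidHom.ext_mint h
  · ext

variable (k : Type) [Field k]

/-- The enveloping algebra of `k[t,t⁻¹]` is a Laurent polynomial ring over `k[t,t⁻¹]`. -/
def envelopingEquiv :
    LaurentPolynomial k ⊗[k] (LaurentPolynomial k)ᵐᵒᵖ ≃ₐ[k]
      LaurentPolynomial (LaurentPolynomial k) :=
  (Algebra.TensorProduct.congr AlgEquiv.refl (AlgEquiv.toOpposite k _).symm).trans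
    ((AddMonoidAlgebra.scalarTensorEquiv k (LaurentPolynomial k)).restrictScalars k)

/-- The element `t ⊗ 1 - 1 ⊗ t` of the enveloping algebra of `k[t,t⁻¹]`. -/
def diagonalElement : LaurentPolynomial k ⊗[k] (LaurentPolynomial k)ᵐᵒᵖ :=
  T 1 ⊗ₜ 1 - 1 ⊗ₜ MulOpposite.op (T 1)

lemma envelopingEquiv_diagonalElement :
    envelopingEquiv k (diagonalElement k) = C (T 1) - T 1 := by
  have h₁ : (T 1 : LaurentPolynomial k) • (1 : LaurentPolynomial (LaurentPolynomial k)) =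
      C (T 1) := by
    rw [smul_eq_C_mul, mul_one]
  have h₂ : AddMonoidAlgebra.mapAlgHom ℤ (Algebra.ofId k (LaurentPolynomial k)) (T 1) = T 1 := by
    simp [T, AddMonoidAlgebra.one_def, -single_eq_C_mul_T]
  simp [envelopingEquiv, diagonalElement, h₁, h₂]

lemma isSMulRegular_diagonalElement :
    IsSMulRegular (LaurentPolynomial k ⊗[k] (LaurentPolynomial k)ᵐᵒᵖ) (diagonalElement k) := by
  have h : envelopingEquiv k (diagonalElement k) ≠ 0 := by
    rw [envelopingEquiv_diagonalElement]
    intro h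
    have h₁ := congrArg (fun p => AddMonoidAlgebra.coeff p 1) (sub_eq_zero.1 h)
    rw [← single_eq_C] at h₁
    simp [T, -single_eq_C_mul_T] at h₁
  intro a b hab
  apply (envelopingEquiv k).injective
  apply mul_left_cancel₀ h
  simpa using congrArg (envelopingEquiv k) hab

lemma smul_one_eq_zero_iff (s : LaurentPolynomial k ⊗[k] (LaurentPolynomial k)ᵐᵒᵖ) :
    s • (1 : LaurentPolynomial k) = 0 ↔ diagonalElement k ∣ s := by
  have smul_tmul (a : LaurentPolynomial k) (b : (LaurentPolynomial k)ᵐᵒᵖ)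
      (x : LaurentPolynomial k) : (a ⊗ₜ[k] b) • x = a * (x * b.unop) := rfl
  constructor
  · intro hs
    let I := Ideal.span {diagonalElement k}
    let q := Ideal.Quotient.mkₐ k I
    have hq : (q.comp Algebra.TensorProduct.includeRight).comp
        (AlgEquiv.toOpposite k (LaurentPolynomial k)).toAlgHom =
        q.comp Algebra.TensorProduct.includeLeft := by
      apply algHom_ext_of_T_one
      refine ((Ideal.Quotient.mk_eq_mk_iff_sub_mem _ _).2 ?_).symm
      exact Ideal.mem_span_singleton_self _
    have key (s : LaurentPolynomial k ⊗[k] (LaurentPolynomial k)ᵐᵒᵖ) :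
        q s = q ((s • (1 : LaurentPolynomial k)) ⊗ₜ 1) := by
      induction s with
      | zero =>
        have h : (0 : LaurentPolynomial k ⊗[k] (LaurentPolynomial k)ᵐᵒᵖ) •
            (1 : LaurentPolynomial k) = 0 :=
          (envModule k (LaurentPolynomial k)).zero_smul 1
        rw [h, zero_tmul]
      | add x y hx hy => rw [map_add, hx, hy, add_smul, add_tmul, map_add]
      | tmul a b =>
        have h := DFunLike.congr_fun hq b.unop
        replace h : q (1 ⊗ₜ b) = q (b.unop ⊗ₜ 1) := h
        rw [smul_tmul, one_mul, ← one_mul b, ← mul_one a, ← Algebra.TensorProduct.tmul_mul_tmul,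
          map_mul, h, ← map_mul]
        simp
    have := key s
    rw [hs, zero_tmul, map_zero] at this
    exact Ideal.mem_span_singleton.1 (Ideal.Quotient.eq_zero_iff_mem.1 this)
  · rintro ⟨c, rfl⟩
    rw [mul_comm, mul_smul, diagonalElement, sub_smul, smul_tmul, smul_tmul]
    simp

end LaurentPolynomial

/-- For a field `k` and the Laurent polynomial ring `R = k[t,t⁻¹]`,
`HH^i_k(R) = Ext^i_{R ⊗[k] Rᵐᵒᵖ}(R, R) = 0` for all `i ≥ 2`. -/
theorem statement7 (k : Type) [Field k] (i : ℕ) (hi : 2 ≤ i) :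
    Subsingleton (HH k i (LaurentPolynomial k) : Type) := by
  have hdim : HasProjectiveDimensionLT (ModuleCat.of
      (LaurentPolynomial k ⊗[k] (LaurentPolynomial k)ᵐᵒᵖ) (LaurentPolynomial k)) 2 := by
    refine hasProjectiveDimensionLT_two_of_regular 1 (fun x => ⟨x ⊗ₜ 1, ?_⟩) _
      (LaurentPolynomial.isSMulRegular_diagonalElement k)
      (LaurentPolynomial.smul_one_eq_zero_iff k)
    change x * (1 * 1) = x
    simp
  obtain ⟨n, rfl⟩ : ∃ n, i = n + 1 := ⟨i - 1, by omega⟩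
  have := HasProjectiveDimensionLT.subsingleton _ 2 _ hi (ModuleCat.of
      (LaurentPolynomial k ⊗[k] (LaurentPolynomial k)ᵐᵒᵖ) (LaurentPolynomial k)) (hX := hdim)
  exact ModuleCat.subsingleton_of_isZero (isZero_Ext_succ_of_subsingleton_abelianExt _ _ n)
end
end

section
/- Let k be a field, let m ≥ 1, and let K = k(x₁, …, x_m) be the field of rational functions in m variables over k. Then for every i ≥ 0 there is an isomorphism of K-vector spaces HH^i_k(K) = Ext^i_{K ⊗_k Kᵐᵒᵖ}(K, K) ≅ Λ^i_K Der_k(K), the i-th exterior power over K of the K-vector space of k-linear derivations of K. -/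
open TensorProduct CategoryTheory

noncomputable section

/-- For a field extension `K` of `k`, the Hochschild cohomology
`HH^n_k(K) := Ext^n_{K ⊗[k] Kᵐᵒᵖ}(K, K)`, computed in the category of modules over the
enveloping algebra `K ⊗[k] Kᵐᵒᵖ`, as a `K`-vector space (the `K`-linear structure coming
from the `K`-algebra structure of `K ⊗[k] Kᵐᵒᵖ` via the left factor). -/
def HHK (k : Type) [Field k] (K : Type) [Field K] [Algebra k K] (n : ℕ) : ModuleCat K :=
  ((Ext K (ModuleCat (K ⊗[k] Kᵐᵒᵖ)) n).obj
      (Opposite.op (ModuleCat.of (K ⊗[k] Kᵐᵒᵖ) K))).obj (ModuleCat.of (K ⊗[k] Kᵐᵒᵖ) K)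

/-- A resolution of `M` by free modules of ranks `r.choose n`, as for the Koszul complex of a
regular sequence of length `r`, all of whose differentials vanish after applying `Hom(-, Y)`. -/
structure KoszulLikeResolution (R Y M : Type) [CommRing R] [AddCommGroup Y] [Module R Y]
    [AddCommGroup M] [Module R M] (r : ℕ) where
  X : ℕ → ModuleCat.{0} R
  basis : ∀ n, Module.Basis (Fin (r.choose n)) R (X n)
  d : ∀ n, X (n + 1) →ₗ[R] X n
  ε : X 0 →ₗ[R] M
  ε_surjective : Function.Surjective ε
  exact_d_ε : Function.Exact (d 0) ε
  exact_d_d : ∀ n, Function.Exact (d (n + 1)) (d n)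
  comp_d_eq_zero : ∀ n (f : X n →ₗ[R] Y), f ∘ₗ d n = 0

namespace KoszulLikeResolution

variable {R Y M M' : Type} [CommRing R] [AddCommGroup Y] [Module R Y]
  [AddCommGroup M] [Module R M] [AddCommGroup M'] [Module R M'] {r : ℕ}

/-- Transport of a resolution along an isomorphism of the resolved modules. -/
def ofEquiv (P : KoszulLikeResolution R Y M r) (e : M ≃ₗ[R] M') :
    KoszulLikeResolution R Y M' r where
  X := P.X
  basis := P.basis
  d := P.d
  ε := e.toLinearMap ∘ₗ P.ε
  ε_surjective := e.surjective.comp P.ε_surjective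
  exact_d_ε x := by simpa using P.exact_d_ε x
  exact_d_d := P.exact_d_d
  comp_d_eq_zero := P.comp_d_eq_zero

/-- The resolution of the ring by itself. -/
def self : KoszulLikeResolution R Y R 0 where
  X n := ModuleCat.of R (Fin (Nat.choose 0 n) → R)
  basis _ := Pi.basisFun R _
  d _ := 0
  ε := LinearMap.proj (R := R) (φ := fun _ : Fin 1 => R) 0
  ε_surjective x := ⟨fun _ => x, rfl⟩
  exact_d_ε x := by
    constructor
    · intro hx
      refine ⟨0, ?_⟩
      ext i
      obtain rfl : i = (0 : Fin 1) := Subsingleton.elim (α := Fin 1) _ _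
      exact hx.symm
    · rintro ⟨y, rfl⟩
      rfl
  exact_d_d n x := ⟨fun _ => ⟨0, funext fun i => i.elim0⟩, fun _ => rfl⟩
  comp_d_eq_zero _ f := LinearMap.comp_zero f

variable (P : KoszulLikeResolution R Y M r) (t : R)

/-- The terms of the mapping cone of multiplication by `t` on a resolution. -/
def coneX : ℕ → ModuleCat.{0} R
  | 0 => P.X 0
  | n + 1 => ModuleCat.of R (P.X (n + 1) × P.X n)

/-- The differentials of the mapping cone of multiplication by `t` on a resolution. -/
def coneD : ∀ n, P.coneX (n + 1) →ₗ[R] P.coneX n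
  | 0 => (P.d 0).coprod (t • LinearMap.id)
  | n + 1 => LinearMap.prod ((P.d (n + 1)).coprod (t • LinearMap.id))
      (-(P.d n) ∘ₗ LinearMap.snd R (P.X (n + 2)) (P.X (n + 1)))

/-- Bases of the terms of the mapping cone. -/
def coneBasis : ∀ n, Module.Basis (Fin ((r + 1).choose n)) R (P.coneX n)
  | 0 => (P.basis 0).reindex (finCongr (by simp))
  | n + 1 => ((P.basis (n + 1)).prod (P.basis n)).reindex
      (finSumFinEquiv.trans (finCongr (by rw [Nat.choose_succ_succ, add_comm])))

/-- If `t` is a nonzerodivisor on `M` acting as zero on `Y`, the mapping cone of multiplication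
by `t` on a resolution of `M` is a resolution of `M / tM`. -/
def cone (ht : IsSMulRegular M t) (hY : ∀ y : Y, t • y = 0) :
    KoszulLikeResolution R Y (QuotSMulTop t M) (r + 1) where
  X := P.coneX
  basis := P.coneBasis
  d := P.coneD t
  ε := (Submodule.mkQ _).comp P.ε
  ε_surjective := (Submodule.mkQ_surjective _).comp P.ε_surjective
  exact_d_ε := by
    intro (x : P.X 0)
    constructor
    · intro hx
      obtain ⟨m, -, hm⟩ := (Submodule.Quotient.mk_eq_zero _).mp hx
      obtain ⟨q, rfl⟩ := P.ε_surjective m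
      obtain ⟨a, ha⟩ := (P.exact_d_ε (x - t • q)).mp (by
        rw [map_sub, map_smul, sub_eq_zero]; exact hm.symm)
      refine ⟨(a, q), ?_⟩
      change P.d 0 a + t • q = x
      rw [ha, sub_add_cancel]
    · rintro ⟨⟨a, b⟩, rfl⟩
      refine (Submodule.Quotient.mk_eq_zero _).mpr ?_
      change P.ε (P.d 0 a + t • b) ∈ _
      rw [map_add, P.exact_d_ε.apply_apply_eq_zero, zero_add, map_smul]
      exact Submodule.smul_mem_pointwise_smul _ _ _ trivial
  exact_d_d n := by
    have key : ∀ (n : ℕ) (a : P.X (n + 1)) (b : P.X n), P.d n a + t • b = 0 →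
        (∃ b' : P.X (n + 1), P.d n b' = -b) →
        ∃ x : P.coneX (n + 2), P.coneD t (n + 1) x = (a, b) := by
      rintro n a b hab ⟨b', hb'⟩
      obtain ⟨a', ha'⟩ := (P.exact_d_d n (a - t • b')).mp (by
        rw [map_sub, map_smul, hb', smul_neg, sub_neg_eq_add, hab])
      refine ⟨(a', b'), Prod.ext ?_ ?_⟩
      · change P.d (n + 1) a' + t • b' = a
        rw [ha', sub_add_cancel]
      · change -(P.d n b') = b
        rw [hb', neg_neg]
    have key' : ∀ (n : ℕ) (a : P.X (n + 2)) (b : P.X (n + 1)),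
        P.d n (P.d (n + 1) a + t • b) + t • (-(P.d n b)) = 0 := by
      intro n a b
      rw [map_add, (P.exact_d_d n).apply_apply_eq_zero, map_smul, zero_add, smul_neg,
        add_neg_cancel]
    rintro ⟨a, b⟩
    cases n with
    | zero =>
      constructor
      · intro h
        have h : P.d 0 a + t • b = 0 := h
        refine key 0 a b h ((P.exact_d_ε (-b)).mp ?_)
        rw [map_neg, neg_eq_zero]
        apply ht
        have := congrArg P.ε h
        simpa [P.exact_d_ε.apply_apply_eq_zero] using this
      · rintro ⟨⟨a', b'⟩, h⟩
        rw [← h]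
        exact key' 0 a' b'
    | succ n =>
      constructor
      · intro h
        have h1 : P.d (n + 1) a + t • b = 0 := congrArg Prod.fst h
        have h2 : -(P.d n b) = 0 := congrArg Prod.snd h
        exact key (n + 1) a b h1 ((P.exact_d_d n (-b)).mp (by rw [map_neg, h2]))
      · rintro ⟨⟨a', b'⟩, h⟩
        rw [← h]
        refine Prod.ext (key' (n + 1) a' b') ?_
        change -(P.d n (-(P.d (n + 1) b'))) = 0
        rw [map_neg, (P.exact_d_d n).apply_apply_eq_zero, neg_zero, neg_zero]
  comp_d_eq_zero n f := by
    have key : ∀ (n : ℕ) (g : P.X n →ₗ[R] Y) (a : P.X (n + 1)), g (P.d n a) = 0 :=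
      fun n g a => LinearMap.congr_fun (P.comp_d_eq_zero n g) a
    refine LinearMap.ext ?_
    rintro ⟨a, b⟩
    cases n with
    | zero =>
      have aux : ∀ g : P.X 0 →ₗ[R] Y, g (P.d 0 a + t • b) = 0 := fun g => by
        rw [map_add, map_smul, hY, add_zero, key]
      exact aux f
    | succ n =>
      have aux : ∀ g : P.X (n + 1) × P.X n →ₗ[R] Y,
          g (P.d (n + 1) a + t • b, -(P.d n b)) = 0 := fun g => by
        have : (P.d (n + 1) a + t • b, -(P.d n b)) =
            (P.d (n + 1) a, 0) + t • (b, 0) + (0, P.d n (-b)) := by ext <;> simp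
        have h₁ := key (n + 1) (g ∘ₗ LinearMap.inl R (P.X (n + 1)) (P.X n)) a
        have h₂ := key n (g ∘ₗ LinearMap.inr R (P.X (n + 1)) (P.X n)) (-b)
        simp only [LinearMap.comp_apply, LinearMap.inl_apply, LinearMap.inr_apply] at h₁ h₂
        rw [this, map_add, map_add, map_smul, hY, h₁, h₂, add_zero, add_zero]
      exact aux f

/-- A module modulo a weakly regular sequence acting as zero on `Y` has a Koszul-like
resolution whenever the module has one. -/
theorem nonempty_of_isWeaklyRegular (rs : List R) (hY : ∀ t ∈ rs, ∀ y : Y, t • y = 0)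
    (P : KoszulLikeResolution R Y M r) (h : RingTheory.Sequence.IsWeaklyRegular M rs) :
    Nonempty (KoszulLikeResolution R Y (M ⧸ (Ideal.ofList rs • ⊤ : Submodule R M))
      (r + rs.length)) := by
  induction rs generalizing M r with
  | nil =>
    refine ⟨P.ofEquiv (Submodule.quotEquivOfEqBot _ ?_).symm⟩
    simp
  | cons t rs ih =>
    rw [RingTheory.Sequence.isWeaklyRegular_cons_iff] at h
    obtain ⟨Q⟩ := ih (fun s hs => hY s (List.mem_cons_of_mem _ hs))
      (P.cone t h.1 (hY t List.mem_cons_self)) h.2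
    have e : r + (t :: rs).length = r + 1 + rs.length := by simp; ring
    rw [e]
    exact ⟨Q.ofEquiv (Submodule.quotOfListConsSMulTopEquivQuotSMulTopInner M t rs).symm⟩

end KoszulLikeResolution

namespace KoszulLikeResolution

variable {R Y M : Type} [CommRing R] [AddCommGroup Y] [Module R Y]
  [AddCommGroup M] [Module R M] {r : ℕ} (P : KoszulLikeResolution R Y M r)

/-- The chain complex underlying a Koszul-like resolution. -/
def complex : ChainComplex (ModuleCat.{0} R) ℕ :=
  ChainComplex.of P.X (fun n => ModuleCat.ofHom (P.d n)) fun n => by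
    ext x
    exact (P.exact_d_d n).apply_apply_eq_zero x

lemma complex_d (n : ℕ) : P.complex.d (n + 1) n = ModuleCat.ofHom (P.d n) :=
  ChainComplex.of_d P.X (fun n => ModuleCat.ofHom (P.d n)) n

lemma complex_exactAt_succ (n : ℕ) : P.complex.ExactAt (n + 1) := by
  rw [HomologicalComplex.exactAt_iff' _ (n + 1 + 1) (n + 1) n (by simp) (by simp),
    ShortComplex.ShortExact.moduleCat_exact_iff_function_exact]
  change Function.Exact (P.complex.d (n + 2) (n + 1)) (P.complex.d (n + 1) n)
  rw [complex_d, complex_d]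
  exact P.exact_d_d n

/-- A Koszul-like resolution, as a projective resolution in the category of modules. -/
def projectiveResolution : ProjectiveResolution (ModuleCat.of R M) where
  complex := P.complex
  projective n := ModuleCat.projective_of_free (P.basis n)
  π := (ChainComplex.toSingle₀Equiv _ _).symm ⟨ModuleCat.ofHom P.ε, by
    rw [P.complex_d]
    ext x
    exact P.exact_d_ε.apply_apply_eq_zero x⟩
  quasiIso := ⟨fun n => by
    cases n
    · rw [ChainComplex.quasiIsoAt₀_iff, ShortComplex.quasiIso_iff_of_zeros']
      · let S : ShortComplex (ModuleCat.{0} R) :=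
          ShortComplex.mk (ModuleCat.ofHom (P.d 0)) (ModuleCat.ofHom P.ε) (by
            ext x
            exact P.exact_d_ε.apply_apply_eq_zero x)
        have hS : S.Exact ∧ Epi S.g :=
          ⟨(ShortComplex.ShortExact.moduleCat_exact_iff_function_exact S).mpr P.exact_d_ε,
            (ModuleCat.epi_iff_surjective _).mpr P.ε_surjective⟩
        refine (ShortComplex.exact_and_epi_g_iff_of_iso ?_).2 hS
        refine ShortComplex.isoMk (Iso.refl _) (Iso.refl _) (Iso.refl _) ?_ ?_
        · change 𝟙 _ ≫ S.f = P.complex.d 1 0 ≫ 𝟙 (P.complex.X 0)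
          rw [Category.id_comp, Category.comp_id]
          exact (P.complex_d 0).symm
        · exact (Category.id_comp (ModuleCat.ofHom P.ε)).trans
            (Category.comp_id (ModuleCat.ofHom P.ε)).symm
      all_goals rfl
    · rw [quasiIsoAt_iff_exactAt']
      · exact P.complex_exactAt_succ _
      · apply ChainComplex.exactAt_succ_single_obj⟩

variable {K : Type} [Field K] [Algebra K R]

lemma linearYonedaObj_d (i j : ℕ) :
    (P.complex.linearYonedaObj K (ModuleCat.of R Y)).d i j = 0 := by
  by_cases h : i + 1 = j
  · subst h
    ext (f : P.X i ⟶ ModuleCat.of R Y)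
    change P.complex.d (i + 1) i ≫ f = 0
    rw [complex_d]
    ext1
    exact P.comp_d_eq_zero i f.hom
  · exact HomologicalComplex.shape _ _ _ h

/-- A Koszul-like resolution computes `Ext` groups, as spaces of functions on a finite set. -/
theorem nonempty_ext_equiv [Module K Y] [IsScalarTower K R Y]
    (P : KoszulLikeResolution R Y M r) (n : ℕ) :
    Nonempty ((((Ext K (ModuleCat R) n).obj (Opposite.op (ModuleCat.of R M))).obj
      (ModuleCat.of R Y) : Type) ≃ₗ[K] (Fin (r.choose n) → Y)) := by
  let e₁ := (P.projectiveResolution.isoExt (R := K) n (ModuleCat.of R Y)).toLinearEquiv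
  let e₂ := (ShortComplex.HomologyData.ofZeros
    ((P.complex.linearYonedaObj K (ModuleCat.of R Y)).sc n) (P.linearYonedaObj_d _ _)
    (P.linearYonedaObj_d _ _)).left.homologyIso.toLinearEquiv
  let e₃ : (P.complex.linearYonedaObj K (ModuleCat.of R Y)).X n ≃ₗ[K] (Fin (r.choose n) → Y) :=
    { ((ModuleCat.homAddEquiv (M := P.X n) (N := ModuleCat.of R Y)).trans
        ((P.basis n).constr ℕ).symm.toAddEquiv) with
      map_smul' c f := by
        ext i
        change algebraMap K R c • f.hom (P.basis n i) = c • f.hom (P.basis n i)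
        rw [algebraMap_smul] }
  exact ⟨e₁ ≪≫ₗ e₂ ≪≫ₗ e₃⟩

end KoszulLikeResolution

section RegularSequence

open RingTheory.Sequence
open scoped Pointwise

/-- If `A / (r) ≃ B` and the image of `rs` is weakly regular on `B`, then `r :: rs` is weakly regular
on `A` as soon as `r` is regular. -/
theorem RingTheory.Sequence.isWeaklyRegular_cons_of_surjective {A B : Type*} [CommRing A]
    [CommRing B] (φ : A →+* B) (hφ : Function.Surjective φ) {r : A}
    (hker : RingHom.ker φ = Ideal.span {r}) (hr : IsSMulRegular A r) {rs : List A}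
    (h : IsWeaklyRegular B (rs.map φ)) : IsWeaklyRegular A (r :: rs) := by
  algebraize [φ]
  refine .cons hr ?_
  have h' : IsWeaklyRegular B rs := (isWeaklyRegular_map_algebraMap_iff B B rs).mp h
  have hk : r • (⊤ : Submodule A A) = LinearMap.ker (Algebra.linearMap A B) := by
    ext a
    have : a ∈ LinearMap.ker (Algebra.linearMap A B) ↔ a ∈ RingHom.ker φ := Iff.rfl
    rw [this, hker, Submodule.mem_smul_pointwise_iff_exists, Ideal.mem_span_singleton]
    simp [dvd_def, eq_comm]
  exact (LinearEquiv.isWeaklyRegular_congr (Submodule.quotEquivOfEq _ _ hk ≪≫ₗ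
    (Algebra.linearMap A B).quotKerEquivOfSurjective hφ) rs).mpr h'

/-- The linear forms `Xᵢ - xᵢ` are a weakly regular sequence in a polynomial ring. -/
theorem MvPolynomial.isWeaklyRegular_X_sub_C {K : Type*} [Field K] {n : ℕ} (x : Fin n → K) :
    IsWeaklyRegular (MvPolynomial (Fin n) K) (List.ofFn fun i => X i - C (x i)) := by
  induction n with
  | zero => simp
  | succ n ih =>
    rw [List.ofFn_succ]
    let e := (finSuccEquiv K n).toRingEquiv
    let ev := Polynomial.evalRingHom (C (σ := Fin n) (x 0))
    have he : e (X 0 - C (x 0)) = Polynomial.X - Polynomial.C (C (x 0)) := by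
      change finSuccEquiv K n _ = _
      rw [map_sub, finSuccEquiv_X_zero, finSuccEquiv_apply]
      simp
    refine isWeaklyRegular_cons_of_surjective (ev.comp e.toRingHom) ?_ ?_ ?_ ?_
    · intro p
      exact ⟨e.symm (Polynomial.C p), by simp [ev]⟩
    · ext p
      rw [RingHom.mem_ker, Ideal.mem_span_singleton, ← map_dvd_iff e, he]
      change Polynomial.eval _ (e p) = 0 ↔ _
      rw [← Polynomial.IsRoot.def, ← Polynomial.dvd_iff_isRoot]
    · rw [isSMulRegular_iff_right_eq_zero_of_smul]
      intro p hp
      refine (mul_eq_zero.mp hp).resolve_left fun h => ?_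
      rw [h, map_zero] at he
      exact Polynomial.X_sub_C_ne_zero _ he.symm
    · have : (List.ofFn fun i : Fin n => (X i.succ - C (x i.succ) :
          MvPolynomial (Fin (n + 1)) K)).map (ev.comp e.toRingHom) =
          List.ofFn fun i => X i - C (x i.succ) := by
        rw [List.map_ofFn]
        congr 1
        ext1 i
        change ev (finSuccEquiv K n _) = _
        rw [map_sub, finSuccEquiv_X_succ, finSuccEquiv_apply]
        simp [ev]
      rw [this]
      exact ih fun i => x i.succ

end RegularSequence

section RationalFunctionField

variable {k F : Type} [Field k] {m : ℕ} [Field F] [Algebra k F]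
  [Algebra (MvPolynomial (Fin m) k) F]

lemma tmul_smul_envModule (a y : F) (b : Fᵐᵒᵖ) :
    (a ⊗ₜ[k] b : F ⊗[k] Fᵐᵒᵖ) • y = a * y * b.unop := by
  change TensorProduct.Algebra.moduleAux _ _ = _
  simp [TensorProduct.Algebra.moduleAux, mul_assoc]

instance : IsScalarTower F (F ⊗[k] Fᵐᵒᵖ) F where
  smul_assoc a z y := by
    induction z with
    | zero =>
      have h : (0 : F ⊗[k] Fᵐᵒᵖ) • y = 0 := Module.zero_smul y
      rw [smul_zero, h, smul_zero]
    | add z w hz hw => rw [smul_add, add_smul, add_smul, smul_add, hz, hw]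
    | tmul b c =>
      rw [TensorProduct.smul_tmul', tmul_smul_envModule, tmul_smul_envModule]
      simp [mul_assoc]

variable (k F m) in
/-- The elements `1 ⊗ op xᵢ - xᵢ ⊗ 1` of the enveloping algebra. -/
def envelopingSequence : List (F ⊗[k] Fᵐᵒᵖ) :=
  List.ofFn fun i : Fin m =>
    1 ⊗ₜ MulOpposite.op (algebraMap (MvPolynomial (Fin m) k) F (MvPolynomial.X i)) -
      algebraMap (MvPolynomial (Fin m) k) F (MvPolynomial.X i) ⊗ₜ 1

lemma smul_eq_zero_of_mem_envelopingSequence {t : F ⊗[k] Fᵐᵒᵖ}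
    (ht : t ∈ envelopingSequence k F m) (y : F) : t • y = 0 := by
  obtain ⟨i, rfl⟩ := List.mem_ofFn.mp ht
  rw [sub_smul, tmul_smul_envModule, tmul_smul_envModule]
  simp [mul_comm]

variable [IsScalarTower k (MvPolynomial (Fin m) k) F]
  [IsFractionRing (MvPolynomial (Fin m) k) F]

/-- The sequence `1 ⊗ op xᵢ - xᵢ ⊗ 1` is weakly regular on the enveloping algebra of the rational
function field. -/
theorem isWeaklyRegular_envelopingSequence :
    RingTheory.Sequence.IsWeaklyRegular (F ⊗[k] Fᵐᵒᵖ) (envelopingSequence k F m) := by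
  let g : MvPolynomial (Fin m) k →ₐ[k] Fᵐᵒᵖ :=
    (AlgEquiv.toOpposite k F).toAlgHom.comp (IsScalarTower.toAlgHom k (MvPolynomial (Fin m) k) F)
  have hg : g.Flat := by
    refine RingHom.Flat.comp (f := algebraMap (MvPolynomial (Fin m) k) F)
      (g := (AlgEquiv.toOpposite k F : F →+* Fᵐᵒᵖ)) ?_
      (.of_bijective (AlgEquiv.toOpposite k F).bijective)
    rw [RingHom.flat_algebraMap_iff]
    exact IsLocalization.flat F (nonZeroDivisors (MvPolynomial (Fin m) k))
  let f : MvPolynomial (Fin m) F →+* F ⊗[k] Fᵐᵒᵖ :=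
    (Algebra.TensorProduct.lTensor (S := k) F g).toRingHom.comp
      (MvPolynomial.algebraTensorAlgEquiv (σ := Fin m) k F).symm.toAlgHom.toRingHom
  have hf : f.Flat :=
    .comp (.of_bijective (MvPolynomial.algebraTensorAlgEquiv k F).symm.bijective) (hg.lTensor F)
  algebraize [f]
  have hX (i : Fin m) : f (MvPolynomial.X i) =
      1 ⊗ₜ MulOpposite.op (algebraMap (MvPolynomial (Fin m) k) F (MvPolynomial.X i)) := by
    change Algebra.TensorProduct.lTensor (S := k) F g
      ((MvPolynomial.algebraTensorAlgEquiv k F).symm _) = _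
    rw [MvPolynomial.algebraTensorAlgEquiv_symm_X]
    rfl
  have hC (a : F) : f (MvPolynomial.C a) = a ⊗ₜ 1 := by
    change Algebra.TensorProduct.lTensor (S := k) F g
      ((MvPolynomial.algebraTensorAlgEquiv k F).symm (algebraMap F _ a)) = _
    rw [AlgEquiv.commutes, Algebra.TensorProduct.algebraMap_apply]
    simp
  have h : envelopingSequence k F m = (List.ofFn fun i : Fin m => MvPolynomial.X i -
      MvPolynomial.C (algebraMap (MvPolynomial (Fin m) k) F (MvPolynomial.X i))).map f := by
    rw [List.map_ofFn]
    refine congrArg List.ofFn (funext fun i => ?_)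
    rw [Function.comp_apply, map_sub, hX, hC]
  rw [h]
  exact (MvPolynomial.isWeaklyRegular_X_sub_C _).of_flat

/-- The sequence `1 ⊗ op xᵢ - xᵢ ⊗ 1` generates the annihilator of `1` in the enveloping
algebra. -/
theorem ofList_envelopingSequence_eq_ker :
    (Ideal.ofList (envelopingSequence k F m) : Ideal (F ⊗[k] Fᵐᵒᵖ)) =
      LinearMap.ker (LinearMap.toSpanSingleton (F ⊗[k] Fᵐᵒᵖ) F 1) := by
  apply le_antisymm
  · rw [Ideal.ofList, Ideal.span_le]
    intro t ht
    exact smul_eq_zero_of_mem_envelopingSequence ht 1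
  · set I : Ideal (F ⊗[k] Fᵐᵒᵖ) := Ideal.ofList (envelopingSequence k F m)
    let π : F ⊗[k] Fᵐᵒᵖ →ₐ[k] (F ⊗[k] Fᵐᵒᵖ) ⧸ I := Ideal.Quotient.mkₐ k I
    let l : F →ₐ[k] (F ⊗[k] Fᵐᵒᵖ) ⧸ I := π.comp Algebra.TensorProduct.includeLeft
    let r : F →ₐ[k] (F ⊗[k] Fᵐᵒᵖ) ⧸ I :=
      (π.comp Algebra.TensorProduct.includeRight).comp (AlgEquiv.toOpposite k F).toAlgHom
    have hlr : r = l := by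
      have : r.comp (IsScalarTower.toAlgHom k (MvPolynomial (Fin m) k) F) =
          l.comp (IsScalarTower.toAlgHom k (MvPolynomial (Fin m) k) F) := by
        refine MvPolynomial.algHom_ext fun i => ?_
        refine Ideal.Quotient.eq.mpr (Ideal.subset_span ?_)
        exact List.mem_ofFn.mpr ⟨i, rfl⟩
      refine AlgHom.coe_ringHom_injective ?_
      refine IsLocalization.ringHom_ext (nonZeroDivisors (MvPolynomial (Fin m) k)) ?_
      exact congrArg AlgHom.toRingHom this
    have key : ∀ z : F ⊗[k] Fᵐᵒᵖ, π z = l (z • (1 : F)) := by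
      intro z
      induction z with
      | zero =>
        have h : (0 : F ⊗[k] Fᵐᵒᵖ) • (1 : F) = 0 := Module.zero_smul _
        rw [map_zero, h, map_zero]
      | add z w hz hw => rw [map_add, add_smul, map_add, hz, hw]
      | tmul a b =>
        rw [tmul_smul_envModule, mul_one, map_mul, ← DFunLike.congr_fun hlr b.unop]
        change π _ = π _ * π _
        rw [← map_mul]
        simp
    intro z hz
    have hz : z • (1 : F) = 0 := hz
    refine Ideal.Quotient.eq_zero_iff_mem.mp ?_
    change π z = 0
    rw [key, hz, map_zero]

variable (k F m) in
theorem nonempty_koszulLikeResolution :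
    Nonempty (KoszulLikeResolution (F ⊗[k] Fᵐᵒᵖ) F F m) := by
  obtain ⟨P⟩ := KoszulLikeResolution.nonempty_of_isWeaklyRegular (envelopingSequence k F m)
    (fun t ht => smul_eq_zero_of_mem_envelopingSequence ht)
    (KoszulLikeResolution.self (Y := F)) isWeaklyRegular_envelopingSequence
  have e : 0 + (envelopingSequence k F m).length = m := by simp [envelopingSequence]
  rw [e] at P
  have hs : Function.Surjective (LinearMap.toSpanSingleton (F ⊗[k] Fᵐᵒᵖ) F 1) := fun y =>
    ⟨y ⊗ₜ 1, by simp [tmul_smul_envModule]⟩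
  exact ⟨P.ofEquiv (Submodule.quotEquivOfEq _ _ (by
    rw [← ofList_envelopingSequence_eq_ker (m := m), Ideal.smul_eq_mul, Ideal.mul_top]) ≪≫ₗ
    LinearMap.quotKerEquivOfSurjective _ hs)⟩

variable (k F m) in
theorem nonempty_derivation_basis : Nonempty (Module.Basis (Fin m) F (Derivation k F F)) := by
  have : Algebra.FormallyEtale (MvPolynomial (Fin m) k) F :=
    .of_isLocalization (nonZeroDivisors (MvPolynomial (Fin m) k))
  let b := (((KaehlerDifferential.mvPolynomialBasis k (Fin m)).baseChange F).map
    (KaehlerDifferential.tensorKaehlerEquivOfFormallyEtale k _ F)).dualBasis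
  exact ⟨b.map (KaehlerDifferential.linearMapEquivDerivation k F)⟩

end RationalFunctionField

/-- Let `k` be a field, `m ≥ 1`, and `K = k(x₁,…,x_m)` the rational function
field.  For every `i ≥ 0` there is an isomorphism of `K`-vector spaces
`HH^i_k(K) = Ext^i_{K ⊗[k] Kᵐᵒᵖ}(K, K) ≅ Λ^i_K Der_k(K)`. -/
theorem statement13 (k : Type) [Field k] (m : ℕ) (hm : 1 ≤ m) (i : ℕ) :
    Nonempty ((HHK k (FractionRing (MvPolynomial (Fin m) k)) i : Type)
      ≃ₗ[FractionRing (MvPolynomial (Fin m) k)]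
        ⋀[FractionRing (MvPolynomial (Fin m) k)]^i
          (Derivation k (FractionRing (MvPolynomial (Fin m) k))
            (FractionRing (MvPolynomial (Fin m) k)))) := by
  obtain ⟨P⟩ := nonempty_koszulLikeResolution k (FractionRing (MvPolynomial (Fin m) k)) m
  obtain ⟨b⟩ := nonempty_derivation_basis k (FractionRing (MvPolynomial (Fin m) k)) m
  obtain ⟨e⟩ := P.nonempty_ext_equiv (K := FractionRing (MvPolynomial (Fin m) k)) i
  have := Module.Finite.of_basis b
  refine ⟨e ≪≫ₗ LinearEquiv.ofFinrankEq _ _ ?_⟩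
  rw [exteriorPower.finrank_eq, Module.finrank_eq_card_basis b, Module.finrank_fin_fun,
    Fintype.card_fin]
end
end

section
/- Let k be a field, let m ≥ 1, and let K = k(x₁, …, x_m) be the field of rational functions in m variables over k. Then the Hochschild cohomology HH^m_k(K) = Ext^m_{K ⊗_k Kᵐᵒᵖ}(K, K) is nonzero. -/
open TensorProduct CategoryTheory

noncomputable section

open RingTheory.Sequence

/-- Pairwise distinct variables form a weakly regular sequence in a polynomial ring. -/
theorem MvPolynomial.isWeaklyRegular_map_X {σ R : Type*} [CommRing R] {l : List σ}
    (hl : l.Nodup) :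
    IsWeaklyRegular (MvPolynomial σ R) (l.map (X : σ → MvPolynomial σ R)) := by
  refine ⟨fun i hi => ?_⟩
  have hi' : i < l.length := by simpa using hi
  have hspan : Ideal.ofList ((l.map (X : σ → MvPolynomial σ R)).take i) =
      Ideal.span (X '' {j | j ∈ l.take i}) := by
    rw [← List.map_take, Ideal.ofList]
    congr 1
    ext
    simp only [List.mem_map, Set.mem_image, Set.mem_ofPred_eq]
  have hmem : l[i] ∉ l.take i := fun h => by
    obtain ⟨j, hj, e⟩ := List.getElem_of_mem h
    rw [List.getElem_take, hl.getElem_inj_iff] at e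
    have := (List.length_take_le i l).trans_lt' hj
    lia
  rw [hspan, smul_eq_mul, Ideal.mul_top, isSMulRegular_iff_right_eq_zero_of_smul]
  intro p
  obtain ⟨p, rfl⟩ := Submodule.Quotient.mk_surjective _ p
  rw [← Submodule.Quotient.mk_smul, Submodule.Quotient.mk_eq_zero, Submodule.Quotient.mk_eq_zero,
    mem_ideal_span_X_image, mem_ideal_span_X_image]
  intro h d hd
  obtain ⟨j, hj, hne⟩ := h (Finsupp.single l[i] 1 + d) (by
    simpa [mem_support_iff, coeff_X_mul] using hd)
  refine ⟨j, hj, ?_⟩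
  have hij : l[i] ≠ j := fun e => hmem (e ▸ hj)
  simpa [Finsupp.single_apply, hij] using hne

/-- If `Ext X Y` computed in the derived category is nontrivial in positive degree, then so is
the derived functor `Ext`. -/
theorem nontrivial_Ext_of_nontrivial_abelianExt {C : Type*} [Category* C] [Abelian C]
    [EnoughProjectives C] [HasExt C] (k : Type*) [Ring k] [Linear k C] {X Y : C} {n : ℕ}
    (h : Nontrivial (Abelian.Ext X Y (n + 1))) :
    Nontrivial (((Ext k C (n + 1)).obj (Opposite.op X)).obj Y) := by
  by_contra hE
  rw [not_nontrivial_iff_subsingleton] at hE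
  let P := projectiveResolution X
  have hz := (ModuleCat.isZero_of_subsingleton _).of_iso (P.isoExt (R := k) (n + 1) Y).symm
  rw [← HomologicalComplex.exactAt_iff_isZero_homology,
    HomologicalComplex.exactAt_iff' _ n (n + 1) (n + 2) (by simp) (by simp),
    ShortComplex.moduleCat_exact_iff] at hz
  apply not_subsingleton (Abelian.Ext X Y (n + 1))
  refine subsingleton_of_forall_eq 0 fun α => ?_
  obtain ⟨f, hf, rfl⟩ := P.extMk_surjective α (n + 2) rfl
  rw [P.extMk_eq_zero_iff _ _ _ _ n rfl]
  exact hz f hf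

/-- If `r` is regular on `M` and kills `Y`, the connecting map
`Extⁿ(M, Y) → Extⁿ⁺¹(M / rM, Y)` is injective, so nontriviality passes along it. -/
theorem IsSMulRegular.nontrivial_ext_quotSMulTop {R : Type} [CommRing R] {M Y : ModuleCat.{0} R}
    {r : R} (hr : IsSMulRegular M r) (hY : ∀ y : Y, r • y = 0) {n : ℕ}
    (h : Nontrivial (Abelian.Ext M Y n)) :
    Nontrivial (Abelian.Ext (ModuleCat.of R (QuotSMulTop r M)) Y (n + 1)) := by
  have hS := hr.smulShortComplex_shortExact
  obtain ⟨α, hα⟩ := exists_ne (0 : Abelian.Ext M Y n)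
  have hY' : r • 𝟙 Y = 0 := by ext y; exact hY y
  refine nontrivial_of_ne (hS.extClass.comp α (add_comm 1 n)) 0 fun h0 => hα ?_
  obtain ⟨β, rfl⟩ := Abelian.Ext.contravariant_sequence_exact₁ hS Y α (add_comm 1 n) h0
  have hzero (β : Abelian.Ext M Y n) : (Abelian.Ext.mk₀ (r • 𝟙 M)).comp β (zero_add n) = 0 := by
    rw [Abelian.Ext.mk₀_smul, Abelian.Ext.smul_comp, Abelian.Ext.mk₀_id_comp,
      Abelian.Ext.smul_eq_comp_mk₀, hY', Abelian.Ext.mk₀_zero, Abelian.Ext.comp_zero]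
  exact hzero β

theorem CategoryTheory.Iso.nontrivial_abelianExt {C : Type*} [Category* C] [Abelian C] [HasExt C]
    {X X' Y : C} (e : X ≅ X') {n : ℕ} (h : Nontrivial (Abelian.Ext X Y n)) :
    Nontrivial (Abelian.Ext X' Y n) :=
  (((Abelian.extFunctor n).mapIso
    e.symm.op).app Y).addCommGroupIsoToAddEquiv.symm.toEquiv.nontrivial_congr.mpr h

theorem RingTheory.Sequence.IsWeaklyRegular.nontrivial_ext {R : Type} [CommRing R]
    {M Y : ModuleCat.{0} R} {rs : List R} (hrs : IsWeaklyRegular M rs)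
    (hY : ∀ r ∈ rs, ∀ y : Y, r • y = 0) {n : ℕ} (h : Nontrivial (Abelian.Ext M Y n)) :
    Nontrivial (Abelian.Ext
      (ModuleCat.of R (M ⧸ (Ideal.ofList rs • ⊤ : Submodule R M))) Y (rs.length + n)) := by
  induction rs generalizing M n with
  | nil =>
    let e : M ≃ₗ[R] (M ⧸ (Ideal.ofList ([] : List R) • ⊤ : Submodule R M)) :=
      (Submodule.quotEquivOfEqBot _ (by rw [Ideal.ofList_nil, Submodule.bot_smul])).symm
    have e' : M ≅ ModuleCat.of R (M ⧸ (Ideal.ofList ([] : List R) • ⊤ : Submodule R M)) :=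
      e.toModuleIso
    simpa only [List.length_nil, zero_add] using e'.nontrivial_abelianExt h
  | cons r rs ih =>
    rw [isWeaklyRegular_cons_iff] at hrs
    have h1 := hrs.1.nontrivial_ext_quotSMulTop (hY r (by simp)) h
    have h2 := ih (M := ModuleCat.of R (QuotSMulTop r M)) hrs.2
      (fun s hs => hY s (by simp [hs])) h1
    rw [List.length_cons, add_right_comm, add_assoc]
    exact (Submodule.quotOfListConsSMulTopEquivQuotSMulTopInner
      M r rs).symm.toModuleIso.nontrivial_abelianExt h2

section RationalFunctions

variable {k σ K : Type} [Field k] [Field K] [Algebra k K] [Algebra (MvPolynomial σ k) K]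

variable (k K) in
/-- The element `xᵢ ⊗ 1 - 1 ⊗ xᵢ` of the enveloping algebra of `k(x₁, …, xₘ)`. -/
def envVarDiff (i : σ) : K ⊗[k] Kᵐᵒᵖ :=
  algebraMap (MvPolynomial σ k) K (.X i) ⊗ₜ[k] 1 -
    1 ⊗ₜ[k] MulOpposite.op (algebraMap (MvPolynomial σ k) K (.X i))

theorem envVarDiff_smul (i : σ) (y : K) :
    (envVarDiff k K i • y : K) = 0 := by
  simp [envVarDiff, sub_smul, TensorProduct.Algebra.smul_def, mul_comm]

variable [IsScalarTower k (MvPolynomial σ k) K] [IsFractionRing (MvPolynomial σ k) K]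

theorem isWeaklyRegular_map_envVarDiff {l : List σ} (hl : l.Nodup) :
    IsWeaklyRegular (K ⊗[k] Kᵐᵒᵖ) (l.map (envVarDiff k K)) := by
  let x (i : σ) : K := algebraMap (MvPolynomial σ k) K (.X i)
  let g : MvPolynomial σ k →ₐ[k] Kᵐᵒᵖ :=
    (AlgEquiv.toOpposite k K).toAlgHom.comp
      (IsScalarTower.toAlgHom k (MvPolynomial σ k) K)
  have hg : g.toRingHom.Flat := by
    have h : (algebraMap (MvPolynomial σ k) K).Flat := by
      rw [RingHom.flat_algebraMap_iff]
      exact IsLocalization.flat K (nonZeroDivisors (MvPolynomial σ k))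
    exact h.comp (RingHom.Flat.of_bijective
      (f := (AlgEquiv.toOpposite k K).toRingEquiv.toRingHom)
      (AlgEquiv.toOpposite k K).bijective)
  let τ : MvPolynomial σ K →ₐ[K] MvPolynomial σ K :=
    MvPolynomial.aeval fun i => MvPolynomial.C (x i) - MvPolynomial.X i
  have hτ : Function.Involutive τ := by
    have h : τ.comp τ = AlgHom.id K _ := by
      ext i
      simp [τ, ← MvPolynomial.algebraMap_eq]
    exact fun p => DFunLike.congr_fun h p
  let e := MvPolynomial.algebraTensorAlgEquiv (σ := σ) k K
  let ψ : K ⊗[k] MvPolynomial σ k →ₐ[K] K ⊗[k] Kᵐᵒᵖ :=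
    Algebra.TensorProduct.map (AlgHom.id K K) g
  let φ : MvPolynomial σ K →ₐ[K] K ⊗[k] Kᵐᵒᵖ := ψ.comp (e.symm.toAlgHom.comp τ)
  have hφ : φ.toRingHom.Flat :=
    RingHom.Flat.comp (f := (e.symm.toAlgHom.comp τ).toRingHom) (g := ψ.toRingHom)
      (.of_bijective (e.symm.bijective.comp hτ.bijective))
      (RingHom.Flat.tensorProductMap (.id _) hg)
  algebraize [φ.toRingHom]
  have hreg := (MvPolynomial.isWeaklyRegular_map_X (R := K) hl).of_flat (S := K ⊗[k] Kᵐᵒᵖ)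
  rw [List.map_map] at hreg
  suffices h : l.map (envVarDiff k K) = l.map (algebraMap (MvPolynomial σ K) (K ⊗[k] Kᵐᵒᵖ) ∘ .X) by
    rw [h]
    exact hreg
  refine List.map_congr_left fun i _ => ?_
  have h : τ (.X i) = algebraMap K _ (x i) - .X i := by simp [τ, MvPolynomial.algebraMap_eq]
  change _ = φ (.X i)
  simp only [φ, AlgHom.comp_apply, h, map_sub, AlgHom.commutes]
  simp [e, ψ, g, x, envVarDiff, Algebra.TensorProduct.algebraMap_apply]

theorem tmul_one_sub_one_tmul_mem_span (a : K) :
    a ⊗ₜ[k] 1 - 1 ⊗ₜ[k] MulOpposite.op a ∈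
      Ideal.span (Set.range (envVarDiff (σ := σ) k K)) := by
  let q := Ideal.Quotient.mk (Ideal.span (Set.range (envVarDiff (σ := σ) k K)))
  let f₁ : K →+* _ := q.comp
    (Algebra.TensorProduct.includeLeft : K →ₐ[k] K ⊗[k] Kᵐᵒᵖ).toRingHom
  let f₂ : K →+* _ := q.comp
    ((Algebra.TensorProduct.includeRight : Kᵐᵒᵖ →ₐ[k] K ⊗[k] Kᵐᵒᵖ).comp
      (AlgEquiv.toOpposite k K).toAlgHom).toRingHom
  have h : f₁ = f₂ := by
    apply IsLocalization.ringHom_ext (nonZeroDivisors (MvPolynomial σ k))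
    apply MvPolynomial.ringHom_ext
    · intro r
      have hr : algebraMap (MvPolynomial σ k) K (.C r) = algebraMap k K r :=
        (IsScalarTower.algebraMap_apply k (MvPolynomial σ k) K r).symm
      change f₁ (algebraMap (MvPolynomial σ k) K (.C r)) =
        f₂ (algebraMap (MvPolynomial σ k) K (.C r))
      rw [hr]
      refine congrArg q (?_ : algebraMap k K r ⊗ₜ[k] (1 : Kᵐᵒᵖ) = 1 ⊗ₜ[k] algebraMap k Kᵐᵒᵖ r)
      rw [Algebra.algebraMap_eq_smul_one, Algebra.algebraMap_eq_smul_one, smul_tmul]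
    · intro i
      exact Ideal.Quotient.eq.mpr (Ideal.subset_span ⟨i, rfl⟩)
  exact Ideal.Quotient.eq.mp (DFunLike.congr_fun h a)

variable (σ) in
theorem ker_toSpanSingleton_env :
    LinearMap.ker (LinearMap.toSpanSingleton (K ⊗[k] Kᵐᵒᵖ) K 1) =
      Ideal.span (Set.range (envVarDiff (σ := σ) k K)) := by
  set I := Ideal.span (Set.range (envVarDiff (σ := σ) k K))
  apply le_antisymm
  · have key (z : K ⊗[k] Kᵐᵒᵖ) : z - (z • (1 : K)) ⊗ₜ[k] 1 ∈ I := by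
      induction z with
      | zero =>
        have h : (0 : K ⊗[k] Kᵐᵒᵖ) • (1 : K) = 0 :=
          (LinearMap.toSpanSingleton (K ⊗[k] Kᵐᵒᵖ) K 1).map_zero
        rw [h, TensorProduct.zero_tmul, sub_zero]
        exact I.zero_mem
      | add y z hy hz =>
        rw [add_smul, TensorProduct.add_tmul, add_sub_add_comm]
        exact I.add_mem hy hz
      | tmul a b =>
        have h := I.mul_mem_left (a ⊗ₜ[k] 1)
          (tmul_one_sub_one_tmul_mem_span (k := k) (σ := σ) b.unop)
        rw [← neg_mem_iff]
        simpa [mul_sub, TensorProduct.Algebra.smul_def] using h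
    intro z hz
    have := key z
    rw [LinearMap.mem_ker, LinearMap.toSpanSingleton_apply] at hz
    simpa [hz] using this
  · rw [Ideal.span_le]
    rintro _ ⟨i, rfl⟩
    rw [SetLike.mem_coe, LinearMap.mem_ker, LinearMap.toSpanSingleton_apply]
    exact envVarDiff_smul i 1

variable (k σ K) in
/-- `k(x₁, …, xₘ)` is the quotient of its enveloping algebra by the ideal generated by the
elements `xᵢ ⊗ 1 - 1 ⊗ xᵢ`. -/
def quotSpanEnvVarDiffEquiv :
    ((K ⊗[k] Kᵐᵒᵖ) ⧸ Ideal.span (Set.range (envVarDiff (σ := σ) k K))) ≃ₗ[K ⊗[k] Kᵐᵒᵖ] K :=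
  (Submodule.quotEquivOfEq _ _ (ker_toSpanSingleton_env σ).symm).trans
    (LinearMap.quotKerEquivOfSurjective _ fun a =>
      ⟨a ⊗ₜ 1, by
        rw [LinearMap.toSpanSingleton_apply, TensorProduct.Algebra.smul_def]
        simp⟩)

end RationalFunctions

theorem nontrivial_ext_self {R : Type} [CommRing R] (Y : ModuleCat.{0} R) [Nontrivial Y] :
    Nontrivial (Abelian.Ext (ModuleCat.of R R) Y 0) :=
  ((Abelian.Ext.homEquiv₀.trans ModuleCat.homEquiv).trans
    (LinearMap.ringLmapEquivSelf R R Y).toEquiv).nontrivial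

theorem RingTheory.Sequence.IsWeaklyRegular.nontrivial_ext_of_equiv {R : Type} [CommRing R]
    {rs : List R} (hrs : IsWeaklyRegular R rs) {X Y : ModuleCat.{0} R} [Nontrivial Y]
    (hY : ∀ r ∈ rs, ∀ y : Y, r • y = 0) (e : (R ⧸ Ideal.ofList rs) ≃ₗ[R] X) :
    Nontrivial (Abelian.Ext X Y rs.length) := by
  have h := IsWeaklyRegular.nontrivial_ext (M := ModuleCat.of R R) hrs hY (nontrivial_ext_self Y)
  let e' : (R ⧸ (Ideal.ofList rs • ⊤ : Submodule R R)) ≃ₗ[R] X :=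
    (Submodule.quotEquivOfEq _ _ (by rw [smul_eq_mul, Ideal.mul_top])).trans e
  have i : ModuleCat.of R (R ⧸ (Ideal.ofList rs • ⊤ : Submodule R R)) ≅ X := e'.toModuleIso
  exact i.nontrivial_abelianExt h

/-- For a field `k`, `m ≥ 1` and the rational function field
`K = k(x₁,…,x_m)` (the fraction field of `k[x₁,…,x_m]`), the Hochschild cohomology
`HH^m_k(K) = Ext^m_{K ⊗[k] Kᵐᵒᵖ}(K, K)` is nonzero. -/
theorem statement14 (k : Type) [Field k] (m : ℕ) (hm : 1 ≤ m) :
    Nontrivial (HH k m (FractionRing (MvPolynomial (Fin m) k)) : Type) := by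
  obtain ⟨n, rfl⟩ : ∃ n, m = n + 1 := ⟨m - 1, by lia⟩
  apply nontrivial_Ext_of_nontrivial_abelianExt
  let K := FractionRing (MvPolynomial (Fin (n + 1)) k)
  let rs := (List.finRange (n + 1)).map (envVarDiff k K)
  have hrs : rs.length = n + 1 := by simp [rs]
  have hspan : Ideal.ofList rs = Ideal.span (Set.range (envVarDiff (σ := Fin (n + 1)) k K)) := by
    rw [Ideal.ofList]
    congr 1
    ext
    simp [rs]
  have h := (isWeaklyRegular_map_envVarDiff (k := k) (K := K)
    (List.nodup_finRange (n + 1))).nontrivial_ext_of_equiv (Y := ModuleCat.of _ K)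
      (X := ModuleCat.of _ K) (fun r hr y => by
        obtain ⟨i, -, rfl⟩ := List.mem_map.mp hr
        exact envVarDiff_smul i y)
      ((Submodule.quotEquivOfEq _ _ hspan).trans (quotSpanEnvVarDiffEquiv k (Fin (n + 1)) K))
  rwa [show ((List.finRange (n + 1)).map (envVarDiff k K)).length = n + 1 from hrs] at h
end
end

section
/- Let k be a field, let m ≥ 1, let K = k(x₁, …, x_m) be the field of rational functions in m variables over k, and let F = K[t, t⁻¹] be the Laurent polynomial ring over K, regarded as a k-algebra. Then for every i ≥ 0 there is an isomorphism of k-vector spaces HH^i_k(F) ≅ HH^i_k(K) ⊕ HH^{i−1}_k(K) (where HH^{−1}_k(K) := 0); in particular HH^{m+1}_k(F) ≠ 0 and HH^s_k(F) = 0 for all s > m + 1. -/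
open TensorProduct CategoryTheory

noncomputable section

section ExtComparison

open CategoryTheory.Abelian

variable {C : Type*} [Category* C] [Abelian C] [HasExt.{0} C] {X Y : C}

namespace CategoryTheory.ProjectiveResolution

lemma extMk_zero_eq_zero_iff (P : ProjectiveResolution X) (f : P.complex.X 0 ⟶ Y)
    (hf : P.complex.d 1 0 ≫ f = 0) : P.extMk f 1 rfl hf = 0 ↔ f = 0 := by
  refine ⟨fun h => ?_, fun h => by subst h; simp⟩
  rw [← P.extEquivCohomologyClass.apply_eq_iff_eq,
    extEquivCohomologyClass_extMk, extEquivCohomologyClass_zero,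
    CochainComplex.HomComplex.CohomologyClass.mk_eq_zero_iff,
    CochainComplex.HomComplex.Cocycle.toSingleMk_mem_coboundaries_iff _ _ _ _ _ 1 (by simp)] at h
  obtain ⟨g, hg⟩ := h
  have h0 : g = 0 := (P.cochainComplex.isZero_of_isStrictlyLE 0 1 (by simp)).eq_of_src _ _
  rw [h0, Limits.comp_zero] at hg
  rw [← cancel_epi (P.cochainComplexXIso (-(0 : ℕ)) 0 rfl).hom, ← hg, Limits.comp_zero]

variable (k : Type*) [CommRing k] [Linear k C]

lemma smul_extMk (P : ProjectiveResolution X) {n : ℕ} (r : k) (f : P.complex.X n ⟶ Y)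
    (hf : P.complex.d (n + 1) n ≫ f = 0) :
    P.extMk (r • f) (n + 1) rfl (by simp [hf]) = r • P.extMk f (n + 1) rfl hf := by
  rw [Ext.smul_eq_comp_mk₀, extMk_comp_mk₀]
  congr 1
  simp

/-- Cocycles of the complex `Hom(P, Y)` give classes in `Ext X Y n`, linearly. -/
def extMkₗ (P : ProjectiveResolution X) (Y : C) (i n : ℕ) :
    LinearMap.ker ((P.complex.linearYonedaObj k Y).sc' i n (n + 1)).g.hom →ₗ[k]
      Abelian.Ext X Y n where
  toFun f := P.extMk f.1 (n + 1) rfl f.2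
  map_add' f g := (P.add_extMk _ _ _ _ f.2 g.2).symm
  map_smul' r f := P.smul_extMk k r f.1 f.2

lemma extMkₗ_surjective (P : ProjectiveResolution X) (Y : C) (i n : ℕ) :
    Function.Surjective (P.extMkₗ k Y i n) := fun α => by
  obtain ⟨f, hf, rfl⟩ := P.extMk_surjective α (n + 1) rfl
  exact ⟨⟨f, hf⟩, rfl⟩

lemma ker_extMkₗ (P : ProjectiveResolution X) (Y : C) (i n : ℕ)
    (hi : (ComplexShape.up ℕ).prev n = i) :
    LinearMap.ker (P.extMkₗ k Y i n) = LinearMap.range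
      ((P.complex.linearYonedaObj k Y).sc' i n (n + 1)).moduleCatToCycles := by
  ext ⟨f, hf⟩
  obtain _ | n := n
  · obtain rfl : i = 0 := by simpa using hi.symm
    refine (P.extMk_zero_eq_zero_iff f hf).trans ⟨?_, ?_⟩
    · rintro rfl
      exact ⟨0, map_zero _⟩
    · rintro ⟨g, hg⟩
      refine (congrArg Subtype.val hg).symm.trans ?_
      change P.complex.d 0 0 ≫ g = 0
      have h0 (g : P.complex.X 0 ⟶ Y) : P.complex.d 0 0 ≫ g = 0 := by simp
      exact h0 g
  · obtain rfl : i = n := by simpa using hi.symm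
    refine (P.extMk_eq_zero_iff f _ rfl hf i rfl).trans ⟨?_, ?_⟩
    · rintro ⟨g, hg⟩
      exact ⟨g, Subtype.ext hg⟩
    · rintro ⟨g, hg⟩
      exact ⟨g, congrArg Subtype.val hg⟩

/-- The left derived functor of `Hom(-, Y)` agrees with the `Ext` of the derived category. -/
def extLinearEquiv [EnoughProjectives C] (P : ProjectiveResolution X) (Y : C) (n : ℕ) :
    (((_root_.Ext k C n).obj (Opposite.op X)).obj Y : Type _) ≃ₗ[k] Abelian.Ext X Y n :=
  (P.isoExt n Y ≪≫ (P.complex.linearYonedaObj k Y).homologyIsoSc' _ n (n + 1) rfl (by simp) ≪≫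
    ShortComplex.moduleCatHomologyIso _).toLinearEquiv ≪≫ₗ
  (Submodule.quotEquivOfEq _ _ (P.ker_extMkₗ k Y _ n rfl).symm) ≪≫ₗ
  (P.extMkₗ k Y _ n).quotKerEquivOfSurjective (P.extMkₗ_surjective k Y _ n)

end CategoryTheory.ProjectiveResolution

end ExtComparison

section KoszulExt

open CategoryTheory.Abelian

/-- The space `Ext X Y n` is a direct sum of `d.choose n` copies of `V`, for all `n`. -/
def HasBinomialExt (k : Type*) [CommRing k] {C : Type*} [Category* C] [Abelian C] [HasExt.{0} C]
    [Linear k C] (X Y : C) (V : Type*) [AddCommGroup V] [Module k V] (d : ℕ) : Prop :=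
  ∀ n, Nonempty (Abelian.Ext X Y n ≃ₗ[k] (Fin (d.choose n) → V))

section Abstract

variable {C : Type*} [Category* C] [Abelian C] [HasExt.{0} C]

lemma mk₀_smul_id_comp_eq_zero {R : Type*} [CommRing R] [Linear R C] {X Y : C} {r : R}
    (hr : r • 𝟙 Y = 0) {n : ℕ} (α : Abelian.Ext X Y n) :
    (Ext.mk₀ (r • 𝟙 X)).comp α (zero_add n) = 0 := by
  rw [Ext.mk₀_smul, Ext.smul_comp, Ext.mk₀_id_comp, Ext.smul_eq_comp_mk₀, hr, Ext.mk₀_zero,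
    Ext.comp_zero]

/-- Isomorphic objects have isomorphic `Ext`. -/
def extLinearEquivOfIso (k : Type*) [CommRing k] [Linear k C] {X X' : C} (e : X ≅ X') (Y : C)
    (n : ℕ) : Abelian.Ext X' Y n ≃ₗ[k] Abelian.Ext X Y n :=
  LinearEquiv.ofLinearMap ((Ext.mk₀ e.hom).precompOfLinear k Y (zero_add n))
    ((Ext.mk₀ e.inv).precompOfLinear k Y (zero_add n))
    (by ext x; simp [Ext.mk₀_comp_mk₀_assoc])
    (by ext x; simp [Ext.mk₀_comp_mk₀_assoc])

lemma HasBinomialExt.of_iso {k : Type*} [CommRing k] [Linear k C] {X X' Y : C}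
    {V : Type*} [AddCommGroup V] [Module k V] {d : ℕ} (h : HasBinomialExt k X Y V d)
    (e : X ≅ X') : HasBinomialExt k X' Y V d :=
  fun n => (h n).map fun f => (extLinearEquivOfIso k e Y n).trans f

variable {k : Type*} [Field k] [Linear k C] {S : ShortComplex C} {Y : C}

lemma nonempty_ext_zero_linearEquiv (hS : S.ShortExact)
    (hf : ∀ α : Abelian.Ext S.X₂ Y 0, (Ext.mk₀ S.f).comp α (zero_add 0) = 0) :
    Nonempty (Abelian.Ext S.X₃ Y 0 ≃ₗ[k] Abelian.Ext S.X₂ Y 0) := by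
  have := hS.epi_g
  refine ⟨LinearEquiv.ofBijective ((Ext.mk₀ S.g).precompOfLinear k Y (zero_add 0))
    ⟨Ext.precomp_mk₀_injective_of_epi Y S.g, fun α => ?_⟩⟩
  exact Ext.contravariant_sequence_exact₂ hS Y α (hf α)

lemma nonempty_ext_succ_linearEquiv (hS : S.ShortExact)
    (hf : ∀ n (α : Abelian.Ext S.X₂ Y n), (Ext.mk₀ S.f).comp α (zero_add n) = 0) (n : ℕ) :
    Nonempty (Abelian.Ext S.X₃ Y (n + 1) ≃ₗ[k]
      Abelian.Ext S.X₂ Y (n + 1) × Abelian.Ext S.X₁ Y n) := by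
  let δ := hS.extClass.precompOfLinear k Y (add_comm 1 n)
  let g := (Ext.mk₀ S.g).precompOfLinear k Y (zero_add (n + 1))
  have hg : Function.Surjective g := fun α =>
    Ext.contravariant_sequence_exact₂ hS Y α (hf _ α)
  have hδ : Function.Injective δ := by
    rw [injective_iff_map_eq_zero]
    intro α hα
    obtain ⟨β, rfl⟩ := Ext.contravariant_sequence_exact₁ hS Y α (add_comm 1 n) hα
    exact hf _ β
  have hex : Function.Exact δ g := fun α => by
    refine ⟨fun h => Ext.contravariant_sequence_exact₃ hS Y α h (add_comm 1 n), ?_⟩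
    rintro ⟨β, rfl⟩
    simp [δ, g]
  obtain ⟨l, hl⟩ := g.exists_rightInverse_of_surjective (LinearMap.range_eq_top.2 hg)
  exact ⟨(hex.splitSurjectiveEquiv hδ ⟨l, hl⟩).1.trans (LinearEquiv.prodComm k _ _)⟩

lemma HasBinomialExt.of_shortExact {V : Type*} [AddCommGroup V] [Module k V] {d : ℕ}
    (h₁ : HasBinomialExt k S.X₁ Y V d) (h₂ : HasBinomialExt k S.X₂ Y V d) (hS : S.ShortExact)
    (hf : ∀ n (α : Abelian.Ext S.X₂ Y n), (Ext.mk₀ S.f).comp α (zero_add n) = 0) :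
    HasBinomialExt k S.X₃ Y V (d + 1) := by
  rintro (_ | n)
  · obtain ⟨e⟩ := nonempty_ext_zero_linearEquiv (k := k) hS (hf 0)
    obtain ⟨e'⟩ := h₂ 0
    exact ⟨e.trans (e'.trans (LinearEquiv.funCongrLeft k V (finCongr (by simp))))⟩
  · obtain ⟨e⟩ := nonempty_ext_succ_linearEquiv (k := k) hS hf n
    obtain ⟨e₁⟩ := h₁ n
    obtain ⟨e₂⟩ := h₂ (n + 1)
    refine ⟨e.trans ((e₂.prodCongr e₁).trans
      ((LinearEquiv.sumArrowLequivProdArrow _ _ k V).symm.trans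
        (LinearEquiv.funCongrLeft k V ((finCongr ?_).trans finSumFinEquiv.symm))))⟩
    rw [Nat.choose_succ_succ, add_comm]

end Abstract

section ModuleCat

variable {k R : Type} [Field k] [CommRing R] [Algebra k R] {Y : Type} [AddCommGroup Y] [Module R Y]

lemma hasBinomialExt_self [Module k Y] [IsScalarTower k R Y] :
    HasBinomialExt k (ModuleCat.of R R) (ModuleCat.of R Y) Y 0 := by
  rintro (_ | n)
  · let e₀ := Ext.linearEquiv₀ (R := k) (X := ModuleCat.of R R) (Y := ModuleCat.of R Y)
    let f : Abelian.Ext (ModuleCat.of R R) (ModuleCat.of R Y) 0 →ₗ[k] Y :=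
      { toFun α := (e₀ α).hom 1
        map_add' α β := by
          rw [map_add]
          rfl
        map_smul' r α := by
          change (e₀ (r • α)).hom 1 = r • (e₀ α).hom 1
          rw [LinearEquiv.map_smul e₀ r α]
          exact algebraMap_smul R r ((e₀ α).hom 1 : Y) }
    have hf : Function.Bijective f := by
      refine ⟨fun α β h => e₀.injective ?_, fun y => ?_⟩
      · ext
        exact h
      · refine ⟨e₀.symm (ModuleCat.ofHom (LinearMap.toSpanSingleton R Y y)), ?_⟩
        change (e₀ (e₀.symm _)).hom 1 = y
        rw [e₀.apply_symm_apply]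
        simp
    exact ⟨(LinearEquiv.ofBijective f hf).trans (LinearEquiv.funUnique (Fin 1) k Y).symm⟩
  · have := Ext.subsingleton_of_projective (ModuleCat.of R R) (ModuleCat.of R Y) n
    rw [Nat.choose_zero_succ]
    exact ⟨0⟩

lemma HasBinomialExt.of_isWeaklyRegular {V : Type*} [AddCommGroup V] [Module k V] (rs : List R)
    (hY : ∀ r ∈ rs, ∀ y : Y, r • y = 0) {M : Type} [AddCommGroup M] [Module R M] {d : ℕ}
    (hM : RingTheory.Sequence.IsWeaklyRegular M rs)
    (h : HasBinomialExt k (ModuleCat.of R M) (ModuleCat.of R Y) V d) :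
    HasBinomialExt k (ModuleCat.of R (M ⧸ (Ideal.ofList rs • ⊤ : Submodule R M)))
      (ModuleCat.of R Y) V (d + rs.length) := by
  induction rs generalizing M d with
  | nil =>
    refine h.of_iso (Submodule.quotEquivOfEqBot (Ideal.ofList [] • ⊤ : Submodule R M)
      (by simp)).symm.toModuleIso
  | cons r rs ih =>
    rw [RingTheory.Sequence.isWeaklyRegular_cons_iff] at hM
    rw [List.length_cons, add_comm rs.length, ← add_assoc]
    refine (ih (fun s hs => hY s (by simp [hs])) hM.2 (M := QuotSMulTop r M) ?_).of_iso
      (Submodule.quotOfListConsSMulTopEquivQuotSMulTopInner M r rs).symm.toModuleIso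
    have hS : ((ModuleCat.of R M).smulShortComplex r).ShortExact :=
      hM.1.smulShortComplex_shortExact
    have hf n := mk₀_smul_id_comp_eq_zero (C := ModuleCat R) (R := R) (X := ModuleCat.of R M)
      (Y := ModuleCat.of R Y) (r := r) (by ext y; exact hY r (by simp) y) (n := n)
    exact HasBinomialExt.of_shortExact (S := (ModuleCat.of R M).smulShortComplex r) h h hS
      fun n α => hf n α

end ModuleCat

end KoszulExt

section Regular

open RingTheory.Sequence Pointwise

lemma IsWeaklyRegular.polynomial_cons {B : Type*} [CommRing B] {rs : List B}
    (h : IsWeaklyRegular B rs) (b : B) :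
    IsWeaklyRegular (Polynomial B) ((Polynomial.X - Polynomial.C b) :: rs.map Polynomial.C) := by
  refine .cons ((Polynomial.monic_X_sub_C b).isRegular.left) ?_
  let r : Polynomial B := Polynomial.X - Polynomial.C b
  have h' : r • (⊤ : Submodule (Polynomial B) (Polynomial B)) = Ideal.span {r} := by
    rw [← Submodule.ideal_span_singleton_smul, smul_eq_mul, Ideal.mul_top]
  let e₁ : QuotSMulTop r (Polynomial B) ≃ₗ[Polynomial B] (Polynomial B ⧸ Ideal.span {r}) :=
    Submodule.quotEquivOfEq _ _ h'
  let e : QuotSMulTop r (Polynomial B) ≃ₗ[B] B := (e₁.restrictScalars B).trans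
    (Polynomial.quotientSpanXSubCAlgEquiv b).toLinearEquiv
  exact (isWeaklyRegular_map_algebraMap_iff (S := Polynomial B) _ rs).2
    ((e.isWeaklyRegular_congr rs).2 h)

lemma isWeaklyRegular_X_sub_C {A : Type*} [CommRing A] {d : ℕ} (a : Fin d → A) :
    IsWeaklyRegular (MvPolynomial (Fin d) A)
      (List.ofFn fun i => MvPolynomial.X i - MvPolynomial.C (a i)) := by
  induction d with
  | zero => simp
  | succ d ih =>
    let e := MvPolynomial.finSuccEquiv A d
    refine (e.toAddEquiv.isWeaklyRegular_congr (bs := List.ofFn fun i =>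
      e (MvPolynomial.X i - MvPolynomial.C (a i))) ?_).2 ?_
    · rw [List.forall₂_iff_get]
      simp [-List.ofFn_succ]
    · convert IsWeaklyRegular.polynomial_cons (ih fun i => a i.succ) (MvPolynomial.C (a 0)) using 1
      simp [List.ofFn_succ, e, MvPolynomial.finSuccEquiv_apply, Function.comp_def]

end Regular

section Envelope

open RingTheory.Sequence

/-- A flat epimorphism of commutative rings. -/
structure IsFlatEpi {A B : Type} [CommRing A] [CommRing B] (f : A →+* B) : Prop where
  flat : f.Flat
  ext : ∀ {R : Type} [CommRing R] (g h : B →+* R), g.comp f = h.comp f → g = h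

lemma IsFlatEpi.comp {A B C : Type} [CommRing A] [CommRing B] [CommRing C] {f : A →+* B}
    {g : B →+* C} (hg : IsFlatEpi g) (hf : IsFlatEpi f) : IsFlatEpi (g.comp f) where
  flat := hf.flat.comp hg.flat
  ext u v h := hg.ext u v (hf.ext _ _ h)

lemma IsFlatEpi.of_ringEquiv {A B : Type} [CommRing A] [CommRing B] (e : A ≃+* B) :
    IsFlatEpi (e : A →+* B) where
  flat := .of_bijective e.bijective
  ext u v h := by
    ext x
    obtain ⟨y, rfl⟩ := e.surjective x
    exact DFunLike.congr_fun h y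

lemma IsFlatEpi.of_isLocalization {A B : Type} [CommRing A] [CommRing B] [Algebra A B]
    (M : Submonoid A) [IsLocalization M B] : IsFlatEpi (algebraMap A B) where
  flat := RingHom.flat_algebraMap_iff.2 (IsLocalization.flat B M)
  ext _ _ h := IsLocalization.ringHom_ext M h

variable {k A : Type} [Field k] [CommRing A] [Algebra k A] {d : ℕ}

/-- The elements `1 ⊗ op (a i) - a i ⊗ 1` of the enveloping algebra. -/
def envDiff (k : Type) {A : Type} [Field k] [CommRing A] [Algebra k A] {d : ℕ} (a : Fin d → A) :
    List (A ⊗[k] Aᵐᵒᵖ) :=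
  List.ofFn fun i => (1 ⊗ₜ MulOpposite.op (a i) - a i ⊗ₜ 1)

lemma isWeaklyRegular_envDiff (φ : MvPolynomial (Fin d) k →ₐ[k] A)
    (hφ : φ.toRingHom.Flat) :
    IsWeaklyRegular (A ⊗[k] Aᵐᵒᵖ) (envDiff k fun i => φ (MvPolynomial.X i)) := by
  let φ' : MvPolynomial (Fin d) k →ₐ[k] Aᵐᵒᵖ := (AlgEquiv.toOpposite k A).toAlgHom.comp φ
  have hφ' : φ'.toRingHom.Flat := hφ.comp (.of_bijective (AlgEquiv.toOpposite k A).bijective)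
  let ψ : MvPolynomial (Fin d) A →+* A ⊗[k] Aᵐᵒᵖ :=
    (Algebra.TensorProduct.map (AlgHom.id A A) φ').toRingHom.comp
      (MvPolynomial.algebraTensorAlgEquiv k A).symm.toRingHom
  have hψ : ψ.Flat := by
    refine .comp (.of_bijective (MvPolynomial.algebraTensorAlgEquiv k A).symm.bijective) ?_
    exact RingHom.Flat.lTensor _ hφ'
  algebraize [ψ]
  have hz : envDiff k (fun i => φ (MvPolynomial.X i)) = (List.ofFn fun i =>
      MvPolynomial.X i - MvPolynomial.C (φ (MvPolynomial.X i))).map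
        (algebraMap (MvPolynomial (Fin d) A) (A ⊗[k] Aᵐᵒᵖ)) := by
    rw [envDiff, List.map_ofFn]
    congr 1
    ext i
    change _ = ψ (_ - _)
    have hC : (MvPolynomial.algebraTensorAlgEquiv k A (σ := Fin d)).symm
        (MvPolynomial.C (φ (MvPolynomial.X i))) = φ (MvPolynomial.X i) ⊗ₜ 1 :=
      (MvPolynomial.algebraTensorAlgEquiv k A).symm.commutes _
    rw [map_sub]
    congr 1
    · simp [ψ, φ']
    · simp [ψ, hC]
  rw [hz]
  exact (isWeaklyRegular_X_sub_C fun i => φ (MvPolynomial.X i)).of_flat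

lemma env_smul_def (x y z : A) : (x ⊗ₜ MulOpposite.op y : A ⊗[k] Aᵐᵒᵖ) • z = x * (z * y) := rfl

lemma isScalarTower_env : IsScalarTower k (A ⊗[k] Aᵐᵒᵖ) A where
  smul_assoc r s x := by
    induction s with
    | zero => rw [smul_zero, zero_smul (A ⊗[k] Aᵐᵒᵖ) x, smul_zero]
    | add s t hs ht => rw [smul_add, add_smul, hs, ht, add_smul, smul_add]
    | tmul a b =>
      induction b using MulOpposite.rec' with
      | _ b => rw [TensorProduct.smul_tmul', env_smul_def, env_smul_def, smul_mul_assoc]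

lemma envDiff_smul (a : Fin d → A) {r : A ⊗[k] Aᵐᵒᵖ} (hr : r ∈ envDiff k a) (x : A) :
    r • x = 0 := by
  obtain ⟨i, rfl⟩ := List.mem_ofFn.1 hr
  rw [sub_smul, ← MulOpposite.op_one, env_smul_def, env_smul_def, one_mul, mul_one, mul_comm,
    sub_self]

/-- The multiplication map `A ⊗[k] Aᵐᵒᵖ → A`, linear over the enveloping algebra. -/
def envMul (k A : Type) [Field k] [CommRing A] [Algebra k A] : A ⊗[k] Aᵐᵒᵖ →ₗ[A ⊗[k] Aᵐᵒᵖ] A :=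
  LinearMap.toSpanSingleton _ A 1

lemma envMul_tmul (a b : A) : envMul k A (a ⊗ₜ MulOpposite.op b) = a * b := by
  rw [envMul, LinearMap.toSpanSingleton_apply, env_smul_def, one_mul]

lemma envMul_surjective : Function.Surjective (envMul k A) := fun a =>
  ⟨a ⊗ₜ MulOpposite.op 1, by rw [envMul_tmul, mul_one]⟩

lemma ker_envMul (φ : MvPolynomial (Fin d) k →ₐ[k] A) (hφ : IsFlatEpi φ.toRingHom) :
    LinearMap.ker (envMul k A) =
      Ideal.ofList (envDiff k fun i => φ (MvPolynomial.X i)) := by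
  set I : Ideal (A ⊗[k] Aᵐᵒᵖ) := Ideal.ofList (envDiff k fun i => φ (MvPolynomial.X i)) with hI
  apply le_antisymm
  · let q : A ⊗[k] Aᵐᵒᵖ →ₐ[k] (A ⊗[k] Aᵐᵒᵖ) ⧸ I := Ideal.Quotient.mkₐ k I
    let f : A →ₐ[k] (A ⊗[k] Aᵐᵒᵖ) ⧸ I := q.comp Algebra.TensorProduct.includeLeft
    let g : A →ₐ[k] (A ⊗[k] Aᵐᵒᵖ) ⧸ I :=
      q.comp (Algebra.TensorProduct.includeRight.comp (AlgEquiv.toOpposite k A).toAlgHom)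
    have hfg : f.toRingHom = g.toRingHom := by
      refine hφ.ext (R := (A ⊗[k] Aᵐᵒᵖ) ⧸ I) f.toRingHom g.toRingHom ?_
      have : f.comp φ = g.comp φ := by
        ext i
        exact ((Ideal.Quotient.mk_eq_mk_iff_sub_mem (I := I) _ _).2
          (Ideal.subset_span (List.mem_ofFn.2 ⟨i, rfl⟩))).symm
      exact congrArg AlgHom.toRingHom this
    have key (s : A ⊗[k] Aᵐᵒᵖ) : q s = f (envMul k A s) := by
      induction s with
      | zero => simp
      | add s t hs ht => rw [map_add, hs, ht, map_add, map_add]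
      | tmul a b =>
        induction b using MulOpposite.rec' with
        | _ b =>
          rw [envMul_tmul, map_mul, show f b = g b from DFunLike.congr_fun hfg b]
          change _ = q (_ * _)
          congr 1
          simp
    intro s hs
    rw [LinearMap.mem_ker] at hs
    have := key s
    rw [hs, map_zero] at this
    exact Ideal.Quotient.eq_zero_iff_mem.1 this
  · rw [hI, Ideal.ofList, Ideal.span_le]
    intro r hr
    exact envDiff_smul _ hr 1

end Envelope

section Hochschild

open MvPolynomial

lemma nonempty_HH_linearEquiv {k A : Type} [Field k] [CommRing A] [Algebra k A] {d : ℕ}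
    (φ : MvPolynomial (Fin d) k →ₐ[k] A) (hφ : IsFlatEpi φ.toRingHom) (n : ℕ) :
    Nonempty (HH k n A ≃ₗ[k] (Fin (d.choose n) → A)) := by
  have := isScalarTower_env (k := k) (A := A)
  have h := HasBinomialExt.of_isWeaklyRegular (k := k) (Y := A) _
    (fun r hr => envDiff_smul (fun i => φ (X i)) hr) (isWeaklyRegular_envDiff φ hφ.flat)
    hasBinomialExt_self
  rw [envDiff, List.length_ofFn, zero_add, ← envDiff] at h
  have e : (A ⊗[k] Aᵐᵒᵖ ⧸ (Ideal.ofList (envDiff k fun i => φ (X i)) •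
      ⊤ : Submodule (A ⊗[k] Aᵐᵒᵖ) (A ⊗[k] Aᵐᵒᵖ))) ≃ₗ[A ⊗[k] Aᵐᵒᵖ] A :=
    (Submodule.quotEquivOfEq _ _ (by rw [ker_envMul φ hφ, smul_eq_mul, Ideal.mul_top])).trans
      ((envMul k A).quotKerEquivOfSurjective envMul_surjective)
  obtain ⟨f⟩ := h.of_iso e.toModuleIso n
  exact ⟨((projectiveResolution (ModuleCat.of (A ⊗[k] Aᵐᵒᵖ) A)).extLinearEquiv k _ n).trans f⟩

lemma isFlatEpi_fractionRing {k : Type} [Field k] (m : ℕ) : IsFlatEpi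
    (IsScalarTower.toAlgHom k (MvPolynomial (Fin m) k)
      (FractionRing (MvPolynomial (Fin m) k))).toRingHom :=
  .of_isLocalization (nonZeroDivisors _)

attribute [local instance] Polynomial.algebra in
lemma IsFlatEpi.polynomial_map {A B : Type} [CommRing A] [CommRing B] [Algebra A B]
    (M : Submonoid A) [IsLocalization M B] : IsFlatEpi (Polynomial.mapRingHom (algebraMap A B)) :=
  have := Polynomial.isLocalization M B
  .of_isLocalization (M.map Polynomial.C)

lemma exists_isFlatEpi_laurentPolynomial {k B : Type} [Field k] [CommRing B] [Algebra k B] {m : ℕ}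
    [Algebra (MvPolynomial (Fin m) k) B] [IsScalarTower k (MvPolynomial (Fin m) k) B]
    (M : Submonoid (MvPolynomial (Fin m) k)) [IsLocalization M B] :
    ∃ φ : MvPolynomial (Fin (m + 1)) k →ₐ[k] LaurentPolynomial B, IsFlatEpi φ.toRingHom := by
  let f : Polynomial (MvPolynomial (Fin m) k) →ₐ[k] Polynomial B :=
    Polynomial.mapAlgHom (IsScalarTower.toAlgHom k _ B)
  let g : Polynomial B →ₐ[k] LaurentPolynomial B := Polynomial.toLaurentAlg.restrictScalars k
  have hf : IsFlatEpi f.toRingHom := .polynomial_map M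
  have hg : IsFlatEpi g.toRingHom :=
    .of_isLocalization (Submonoid.powers (Polynomial.X : Polynomial B))
  exact ⟨(g.comp f).comp (finSuccEquiv k m).toAlgHom,
    (hg.comp hf).comp (.of_ringEquiv (finSuccEquiv k m).toRingEquiv)⟩

lemma nonempty_laurentPolynomial_linearEquiv {k K : Type} [Field k] [CommRing K] [Algebra k K]
    (h : Cardinal.aleph0 ≤ Module.rank k K) : Nonempty (LaurentPolynomial K ≃ₗ[k] K) := by
  have h' : Module.rank k (ℤ →₀ K) = Module.rank k K := by
    rw [rank_finsupp]
    simp [Cardinal.aleph0_mul_eq h]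
  obtain ⟨e⟩ := nonempty_linearEquiv_of_rank_eq h'
  exact ⟨(AddMonoidAlgebra.coeffLinearEquiv k).trans e⟩

lemma aleph0_le_rank_fractionRing {k : Type} [Field k] {m : ℕ} (hm : 1 ≤ m) :
    Cardinal.aleph0 ≤ Module.rank k (FractionRing (MvPolynomial (Fin m) k)) := by
  have : Nonempty (Fin m) := ⟨⟨0, hm⟩⟩
  have h := LinearMap.rank_le_of_injective
    (IsScalarTower.toAlgHom k (MvPolynomial (Fin m) k)
      (FractionRing (MvPolynomial (Fin m) k))).toLinearMap (IsFractionRing.injective _ _)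
  refine le_trans ?_ h
  rw [MvPolynomial.rank_eq]
  exact Cardinal.aleph0_le_mk _

end Hochschild

/-- Let `k` be a field, `m ≥ 1`, `K = k(x₁,…,x_m)` the rational function field
and `F = K[t,t⁻¹]` the Laurent polynomial ring over `K`, regarded as a `k`-algebra.  Then for
every `i ≥ 0` there is a `k`-linear isomorphism `HH^i_k(F) ≅ HH^i_k(K) ⊕ HH^{i-1}_k(K)`
(where `HH^{-1}_k(K) := 0`, so `HH^0_k(F) ≅ HH^0_k(K)`); in particular `HH^{m+1}_k(F) ≠ 0`
and `HH^s_k(F) = 0` for all `s > m + 1`. -/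
theorem statement16 (k : Type) [Field k] (m : ℕ) (hm : 1 ≤ m) :
    Nonempty ((HH k 0 (LaurentPolynomial (FractionRing (MvPolynomial (Fin m) k))) : Type)
        ≃ₗ[k] (HH k 0 (FractionRing (MvPolynomial (Fin m) k)) : Type)) ∧
    (∀ i : ℕ,
      Nonempty ((HH k (i + 1) (LaurentPolynomial (FractionRing (MvPolynomial (Fin m) k))) : Type)
        ≃ₗ[k] ((HH k (i + 1) (FractionRing (MvPolynomial (Fin m) k)) : Type) ×
               (HH k i (FractionRing (MvPolynomial (Fin m) k)) : Type)))) ∧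
    Nontrivial (HH k (m + 1) (LaurentPolynomial (FractionRing (MvPolynomial (Fin m) k))) : Type) ∧
    (∀ s : ℕ, m + 1 < s →
      Subsingleton (HH k s (LaurentPolynomial (FractionRing (MvPolynomial (Fin m) k))) : Type)) := by
  have hK := nonempty_HH_linearEquiv _ (isFlatEpi_fractionRing (k := k) m)
  obtain ⟨φ, hφ⟩ := exists_isFlatEpi_laurentPolynomial (k := k)
    (B := FractionRing (MvPolynomial (Fin m) k)) (nonZeroDivisors (MvPolynomial (Fin m) k))
  have hF := nonempty_HH_linearEquiv φ hφ
  obtain ⟨e⟩ := nonempty_laurentPolynomial_linearEquiv (aleph0_le_rank_fractionRing (k := k) hm)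
  refine ⟨?_, fun i => ?_, ?_, fun s hs => ?_⟩
  · obtain ⟨f⟩ := hF 0
    obtain ⟨g⟩ := hK 0
    refine ⟨f.trans ((LinearEquiv.piCongrRight fun _ => e).trans
      ((LinearEquiv.funCongrLeft k _ (finCongr ?_)).trans g.symm))⟩
    rw [Nat.choose_zero_right, Nat.choose_zero_right]
  · obtain ⟨f⟩ := hF (i + 1)
    obtain ⟨g⟩ := hK (i + 1)
    obtain ⟨g'⟩ := hK i
    refine ⟨f.trans ((LinearEquiv.piCongrRight fun _ => e).trans
      ((LinearEquiv.funCongrLeft k _ (finSumFinEquiv.trans (finCongr ?_))).trans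
        ((LinearEquiv.sumArrowLequivProdArrow _ _ k _).trans (g.symm.prodCongr g'.symm))))⟩
    rw [Nat.choose_succ_succ, add_comm]
  · obtain ⟨f⟩ := hF (m + 1)
    rw [Nat.choose_self] at f
    exact f.toEquiv.nontrivial
  · obtain ⟨f⟩ := hF s
    rw [Nat.choose_eq_zero_of_lt hs] at f
    exact f.toEquiv.subsingleton
end
end
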